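/- Let (R, m) be a Cohen-Macaulay commutative noetherian local ring and X a nonfree maximal Cohen-Macaulay R-module. Then there exists a nonfree maximal Cohen-Macaulay R-module Y such that step(X,Y) ≤ 2·dim Sing R and Y is free on the punctured spectrum of R, i.e., Y_p is a free R_p-module for every prime ideal p ≠ m. -/

import Mathlib

open CategoryTheory

noncomputable section

variable (R : Type) [CommRing R]

/-- The nonfree locus of a module: primes where the localization is not free. -/
def nonfreeLocus (M : ModuleCat R) : Set (PrimeSpectrum R) :=
  {p | ¬ Module.Free (Localization.AtPrime p.asIdeal)
      (LocalizedModule p.asIdeal.primeCompl M)}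

/-- The nonfree locus of a class of modules. -/
def nonfreeLocusSet (𝒳 : Set (ModuleCat R)) : Set (PrimeSpectrum R) :=
  ⋃ X ∈ 𝒳, nonfreeLocus R X

/-- `N` is a direct summand of `M`. -/
def IsSummand (N M : ModuleCat R) : Prop :=
  ∃ (i : N ⟶ M) (p : M ⟶ N), i ≫ p = 𝟙 N

/-- `0 → L → M → N → 0` is a short exact sequence. -/
def SES (L M N : ModuleCat R) : Prop :=
  ∃ (f : L ⟶ M) (g : M ⟶ N),
    Function.Injective f ∧ Function.Surjective g ∧ Function.Exact f g

/-- A resolving class of finitely generated modules. -/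
structure IsResolving (𝒳 : Set (ModuleCat R)) : Prop where
  finite : ∀ M ∈ 𝒳, Module.Finite R M
  iso_closed : ∀ M N : ModuleCat R, Nonempty (M ≅ N) → M ∈ 𝒳 → N ∈ 𝒳
  proj_mem : ∀ M : ModuleCat R, Module.Finite R M → Module.Projective R M → M ∈ 𝒳
  summand_closed : ∀ M N : ModuleCat R, IsSummand R N M → M ∈ 𝒳 → N ∈ 𝒳
  ext_closed : ∀ L M N : ModuleCat R, SES R L M N → L ∈ 𝒳 → N ∈ 𝒳 → M ∈ 𝒳
  ker_epi_closed : ∀ L M N : ModuleCat R, SES R L M N → M ∈ 𝒳 → N ∈ 𝒳 → L ∈ 𝒳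

/-- The resolving closure of a class of modules. -/
def resClosure (𝒳 : Set (ModuleCat R)) : Set (ModuleCat R) :=
  ⋂₀ {𝒴 | IsResolving R 𝒴 ∧ 𝒳 ⊆ 𝒴}

/-- Finite direct sum of a family of modules. -/
def finDirectSum {n : ℕ} (f : Fin n → ModuleCat R) : ModuleCat R :=
  ModuleCat.of R (∀ i, f i)

/-- The class `res^n X`. -/
def resStep (X : ModuleCat R) : ℕ → Set (ModuleCat R)
  | 0 => {M | ∃ (n : ℕ) (f : Fin n → ModuleCat R),
      (∀ i, f i = X ∨ f i = ModuleCat.of R R) ∧ IsSummand R M (finDirectSum R f)}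
  | (n+1) => {M | ∃ (t : ℕ) (f : Fin t → ModuleCat R),
      (∀ i, (∃ A B, A ∈ resStep X n ∧ B ∈ resStep X n ∧ SES R A (f i) B) ∨
            (∃ A B, A ∈ resStep X n ∧ B ∈ resStep X n ∧ SES R (f i) A B)) ∧
      IsSummand R M (finDirectSum R f)}

/-- `step(X,Y)` : the least `n` with `Y ∈ res^n X`. -/
def step (X Y : ModuleCat R) : ℕ∞ :=
  sInf {n : ℕ∞ | ∃ m : ℕ, n = (m : ℕ∞) ∧ Y ∈ resStep R X m}

/-- A module is indecomposable. -/
def Indec (M : ModuleCat R) : Prop :=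
  Nontrivial M ∧ ∀ (A B : ModuleCat R), Nontrivial A → Nontrivial B →
    IsEmpty (M ≅ ModuleCat.of R (A × B))

/-- `Ext¹`. -/
def ext1 (X Y : ModuleCat R) : ModuleCat R :=
  ((Ext R (ModuleCat R) 1).obj (Opposite.op X)).obj Y

/-- Dimension of a subset of `Spec R` : `sup { dim R/p }`. -/
def dimSet (Z : Set (PrimeSpectrum R)) : WithBot ℕ∞ :=
  ⨆ p ∈ Z, ringKrullDim (R ⧸ (p : PrimeSpectrum R).asIdeal)

/-- The height of `p` with respect to a subset `Z` of `Spec R`. -/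
def heightWithin (Z : Set (PrimeSpectrum R)) (p : PrimeSpectrum R) : ℕ∞ :=
  ⨆ q ∈ Z, ⨆ (h : q ≤ p), Order.height (α := Set.Icc q p) ⟨p, ⟨h, le_rfl⟩⟩

/-- Depth of a module over a local ring : the supremum of lengths of regular
sequences contained in the maximal ideal. -/
def moduleDepth [IsLocalRing R] (M : Type) [AddCommGroup M] [Module R M] : ℕ∞ :=
  ⨆ (rs : List R) (_ : (∀ r ∈ rs, r ∈ IsLocalRing.maximalIdeal R) ∧
      RingTheory.Sequence.IsRegular M rs), (rs.length : ℕ∞)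

/-- The singular locus: primes `p` such that `R_p` is not regular, i.e. the maximal
ideal of `R_p` cannot be generated by `dim R_p` elements. -/
def singularLocus : Set (PrimeSpectrum R) :=
  {p | ¬ ∃ (s : Finset (Localization.AtPrime p.asIdeal)),
      Ideal.span (s : Set (Localization.AtPrime p.asIdeal)) =
        IsLocalRing.maximalIdeal (Localization.AtPrime p.asIdeal) ∧
      (s.card : WithBot ℕ∞) = ringKrullDim (Localization.AtPrime p.asIdeal)}

end

section Depth

open RingTheory.Sequence IsLocalRing Limits Pointwise

universe u

variable {R : Type u} [CommRing R]

/-- `M` has depth at least `n`: there is a weakly `M`-regular sequence of length `n` inside the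
maximal ideal. The zero module has depth at least `n` for every `n`. -/
def DepthGE (R : Type u) [CommRing R] [IsLocalRing R] (n : ℕ) (M : Type u) [AddCommGroup M]
    [Module R M] : Prop :=
  ∃ rs : List R, rs.length = n ∧ (∀ r ∈ rs, r ∈ maximalIdeal R) ∧ IsWeaklyRegular M rs

theorem isWeaklyRegular_of_subsingleton (M : Type u) [AddCommGroup M] [Module R M]
    [Subsingleton M] (rs : List R) : IsWeaklyRegular M rs where
  regular_mod_prev _ _ := Function.injective_of_subsingleton _

theorem depthGE_iff_subsingleton_ext [IsLocalRing R] [IsNoetherianRing R] (n : ℕ) (M : Type u)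
    [AddCommGroup M] [Module R M] [Module.Finite R M] :
    DepthGE R n M ↔ ∀ i < n, Subsingleton
      (Abelian.Ext (ModuleCat.of R (Shrink.{u} (R ⧸ maximalIdeal R))) (ModuleCat.of R M) i) := by
  cases subsingleton_or_nontrivial M with
  | inl h =>
    refine iff_of_true ⟨List.replicate n 0, by simp, ?_, isWeaklyRegular_of_subsingleton M _⟩ ?_
    · intro r hr
      rw [List.eq_of_mem_replicate hr]
      exact zero_mem _
    · intro i _
      have hz : IsZero (ModuleCat.of R M) := ModuleCat.isZero_of_subsingleton _
      refine subsingleton_of_forall_eq 0 fun a => ?_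
      rw [← a.comp_mk₀_id, hz.eq_of_src (𝟙 _) 0, Abelian.Ext.mk₀_zero, Abelian.Ext.comp_zero]
  | inr h =>
    have hlt : maximalIdeal R • (⊤ : Submodule R M) < ⊤ :=
      (Submodule.top_ne_ideal_smul_of_le_jacobson_annihilator
        (maximalIdeal_le_jacobson _)).symm.lt_top
    refine Iff.trans ?_
      ((ModuleCat.exists_isRegular_tfae (maximalIdeal R) n (ModuleCat.of R M) hlt).out 3 1)
    constructor
    · rintro ⟨rs, hn, hm, hr⟩
      exact ⟨rs, hn, hm, IsRegular.of_isWeaklyRegular_of_mem_maximalIdeal _ hm hr⟩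
    · rintro ⟨rs, hn, hm, hr⟩
      exact ⟨rs, hn, hm, hr.toIsWeaklyRegular⟩

theorem exists_isSMulRegular_mem_of_not_le_associatedPrimes [IsNoetherianRing R] {M : Type*}
    [AddCommGroup M] [Module R M] [Module.Finite R M] (I : Ideal R)
    (h : ∀ q ∈ associatedPrimes R M, ¬ I ≤ q) : ∃ x ∈ I, IsSMulRegular M x := by
  by_contra! hcon
  have hsub : (I : Set R) ⊆ ⋃ q ∈ associatedPrimes R M, (q : Set R) := by
    rw [biUnion_associatedPrimes_eq_compl_regular]
    exact hcon
  obtain ⟨q, hq, hle⟩ := (Ideal.subset_union_prime_finite (associatedPrimes.finite R M) (f := id)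
    ⊥ ⊥ (fun q hq _ _ => hq.isPrime)).mp hsub
  exact h q hq hle

variable [IsLocalRing R] [IsNoetherianRing R]
  {L M N : Type u} [AddCommGroup L] [AddCommGroup M] [AddCommGroup N]
  [Module R L] [Module R M] [Module R N]
  [Module.Finite R L] [Module.Finite R M] [Module.Finite R N]

theorem DepthGE.mono {m n : ℕ} (hmn : m ≤ n) (h : DepthGE R n M) : DepthGE R m M := by
  rw [depthGE_iff_subsingleton_ext] at h ⊢
  exact fun i hi => h i (hi.trans_le hmn)

theorem DepthGE.extension {n : ℕ} {f : L →ₗ[R] M} {g : M →ₗ[R] N} (hf : Function.Injective f)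
    (hg : Function.Surjective g) (hfg : Function.Exact f g) (hL : DepthGE R n L)
    (hN : DepthGE R n N) : DepthGE R n M := by
  rw [depthGE_iff_subsingleton_ext] at *
  intro i hi
  have hS := ModuleCat.shortComplex_shortExact
    (ModuleCat.shortComplexOfCompEqZero f g hfg.linearMap_comp_eq_zero) hfg hf hg
  have h1 := AddCommGrpCat.isZero_of_iff_subsingleton.mpr (hL i hi)
  have h2 := AddCommGrpCat.isZero_of_iff_subsingleton.mpr (hN i hi)
  exact AddCommGrpCat.subsingleton_of_isZero <| ShortComplex.Exact.isZero_of_both_zeros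
    (Abelian.Ext.covariant_sequence_exact₂' _ hS i) (h1.eq_zero_of_src _) (h2.eq_zero_of_tgt _)

theorem DepthGE.kernel {n : ℕ} {f : L →ₗ[R] M} {g : M →ₗ[R] N} (hf : Function.Injective f)
    (hg : Function.Surjective g) (hfg : Function.Exact f g) (hM : DepthGE R n M)
    (hN : DepthGE R n N) : DepthGE R n L := by
  rw [depthGE_iff_subsingleton_ext] at *
  intro i hi
  have hS := ModuleCat.shortComplex_shortExact
    (ModuleCat.shortComplexOfCompEqZero f g hfg.linearMap_comp_eq_zero) hfg hf hg
  have h1 := AddCommGrpCat.isZero_of_iff_subsingleton.mpr (hM i hi)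
  cases i with
  | zero =>
    have : Mono (ModuleCat.ofHom f) := (ModuleCat.mono_iff_injective _).mpr hf
    have hs : Subsingleton (ModuleCat.of R (Shrink.{u} (R ⧸ maximalIdeal R)) ⟶
        ModuleCat.of R M) := Abelian.Ext.addEquiv₀.subsingleton_congr.mp (hM 0 hi)
    refine Abelian.Ext.addEquiv₀.subsingleton_congr.mpr ⟨fun a b => ?_⟩
    exact (cancel_mono (ModuleCat.ofHom f)).mp (Subsingleton.elim _ _)
  | succ i =>
    have h2 := AddCommGrpCat.isZero_of_iff_subsingleton.mpr (hN i (by omega))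
    exact AddCommGrpCat.subsingleton_of_isZero <| ShortComplex.Exact.isZero_of_both_zeros
      (Abelian.Ext.covariant_sequence_exact₁' _ hS i (i + 1) rfl) (h2.eq_zero_of_src _)
      (h1.eq_zero_of_tgt _)

theorem DepthGE.quotSMulTop {n : ℕ} {x : R} (hx : IsSMulRegular M x) (h : DepthGE R (n + 1) M) :
    DepthGE R n (QuotSMulTop x M) := by
  rw [depthGE_iff_subsingleton_ext] at *
  intro i hi
  have hx' : IsSMulRegular (ModuleCat.of R M) x := hx
  have h1 := AddCommGrpCat.isZero_of_iff_subsingleton.mpr (h i (by omega))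
  have h2 := AddCommGrpCat.isZero_of_iff_subsingleton.mpr (h (i + 1) (by omega))
  exact AddCommGrpCat.subsingleton_of_isZero <| ShortComplex.Exact.isZero_of_both_zeros
    (Abelian.Ext.covariant_sequence_exact₃' _ hx'.smulShortComplex_shortExact i (i + 1) rfl)
    (h1.eq_zero_of_src _) (h2.eq_zero_of_tgt _)

theorem DepthGE.pi_fin {n : ℕ} (h : DepthGE R n M) (k : ℕ) : DepthGE R n (Fin k → M) := by
  induction k with
  | zero =>
    exact ⟨List.replicate n 0, by simp, fun r hr => by
      rw [List.eq_of_mem_replicate hr]; exact zero_mem _, isWeaklyRegular_of_subsingleton _ _⟩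
  | succ k ih =>
    refine DepthGE.extension (f := LinearMap.single R (fun _ : Fin (k + 1) => M) 0)
      (g := LinearMap.funLeft R M Fin.succ) (Pi.single_injective (M := fun _ : Fin (k + 1) => M) 0)
      (LinearMap.funLeft_surjective_of_injective R M _ (Fin.succ_injective _)) ?_ h ih
    intro v
    constructor
    · intro hv
      refine ⟨v 0, funext fun i => ?_⟩
      refine Fin.cases (by simp) (fun j => ?_) i
      have := congrFun hv j
      simpa [LinearMap.funLeft_apply, eq_comm] using this
    · rintro ⟨a, rfl⟩
      ext j
      simp [LinearMap.funLeft_apply]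

theorem ringKrullDim_quotient_eq_coheight {A : Type*} [CommRing A] (p : PrimeSpectrum A) :
    ringKrullDim (A ⧸ p.asIdeal) = Order.coheight p := by
  rw [ringKrullDim_quotient, Order.coheight_eq_krullDim_Ici]
  congr

theorem DepthGE.le_coheight_of_mem_associatedPrimes {n : ℕ} (h : DepthGE R n M)
    (q : PrimeSpectrum R) (hq : q.asIdeal ∈ associatedPrimes R M) :
    (n : ℕ∞) ≤ Order.coheight q := by
  induction n generalizing M q with
  | zero => simp
  | succ n ih =>
    obtain ⟨rs, hlen, hmem, hreg⟩ := id h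
    obtain ⟨x, rs, rfl⟩ := List.exists_cons_of_length_eq_add_one hlen
    rw [isWeaklyRegular_cons_iff] at hreg
    have hxm : x ∈ maximalIdeal R := hmem x List.mem_cons_self
    have hxq : x ∉ q.asIdeal := fun hx => by
      have : x ∈ ⋃ p ∈ associatedPrimes R M, (p : Set R) := Set.mem_biUnion hq hx
      rw [biUnion_associatedPrimes_eq_compl_regular] at this
      exact this hreg.1
    -- the submodule of elements killed by `q`
    let K : Submodule R M := Submodule.torsionBySet R M (q.asIdeal : Set R)
    have hK : ∀ z : M, z ∈ K ↔ ∀ a ∈ q.asIdeal, a • z = 0 := fun z => by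
      simp [K, Submodule.mem_torsionBySet_iff]
    have hK0 : K ≠ ⊥ := by
      obtain ⟨-, z, hz⟩ := isAssociatedPrime_iff.mp hq
      intro hbot
      have hzK : z ∈ K := (hK z).mpr fun a ha => by
        rw [hz] at ha
        simpa [Submodule.mem_colon_singleton] using ha
      rw [hbot, Submodule.mem_bot] at hzK
      apply q.2.ne_top
      rw [hz, hzK]
      ext; simp [Submodule.mem_colon_singleton]
    obtain ⟨z, hzK, hzx⟩ : ∃ z ∈ K, z ∉ x • (⊤ : Submodule R M) := by
      by_contra! hcon
      refine hK0 (Submodule.eq_bot_of_le_smul_of_le_jacobson_bot (maximalIdeal R) K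
        (IsNoetherian.noetherian K) ?_ (jacobson_eq_maximalIdeal ⊥ bot_ne_top).ge)
      intro z hz
      obtain ⟨w, -, rfl⟩ := (Submodule.mem_smul_pointwise_iff_exists _ _ _).mp (hcon z hz)
      refine Submodule.smul_mem_smul hxm ((hK w).mpr fun a ha => ?_)
      have := (hK _).mp hz a ha
      rw [smul_comm] at this
      exact hreg.1.right_eq_zero_of_smul this
    obtain ⟨P, hP, hle⟩ := exists_le_isAssociatedPrime_of_isNoetherianRing R
      (Submodule.Quotient.mk z : QuotSMulTop x M) (by rwa [Ne, Submodule.Quotient.mk_eq_zero])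
    have hqP : q < ⟨P, hP.isPrime⟩ := by
      rw [← PrimeSpectrum.asIdeal_lt_asIdeal]
      refine lt_of_le_of_ne (fun a ha => hle ?_) ?_
      · rw [Submodule.mem_colon_singleton, ← Submodule.Quotient.mk_smul, (hK z).mp hzK a ha]
        simp
      · rintro heq
        apply hxq
        rw [heq]
        apply hle
        rw [Submodule.mem_colon_singleton, Submodule.mem_bot]
        exact Module.mem_annihilator.mp (QuotSMulTop.mem_annihilator _ x) _
    have := ih (h.quotSMulTop hreg.1) ⟨P, hP.isPrime⟩ hP
    push_cast
    exact (add_le_add_left this 1).trans (Order.coheight_add_one_le hqP)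

theorem DepthGE.exists_isWeaklyRegular_mem {n k : ℕ} (h : DepthGE R n M) (p : PrimeSpectrum R)
    (hk : (k : ℕ∞) + Order.coheight p ≤ n) :
    ∃ rs : List R, rs.length = k ∧ (∀ r ∈ rs, r ∈ p.asIdeal) ∧ IsWeaklyRegular M rs := by
  induction k generalizing M n with
  | zero => exact ⟨[], rfl, by simp, .nil R M⟩
  | succ k ih =>
    obtain ⟨x, hxp, hx⟩ := exists_isSMulRegular_mem_of_not_le_associatedPrimes (M := M) p.asIdeal
      fun q hq hle => by
        have h1 := h.le_coheight_of_mem_associatedPrimes ⟨q, hq.isPrime⟩ hq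
        have h2 : Order.coheight (⟨q, hq.isPrime⟩ : PrimeSpectrum R) ≤ Order.coheight p :=
          Order.coheight_anti hle
        have h3 := hk.trans (h1.trans h2)
        have h4 : Order.coheight p ≠ ⊤ := fun ht => by simp [ht] at hk
        lift Order.coheight p to ℕ using h4 with c
        norm_cast at h3
        omega
    obtain ⟨n, rfl⟩ : ∃ m, n = m + 1 := Nat.exists_eq_succ_of_ne_zero (by
      rintro rfl
      simp at hk)
    obtain ⟨rs, hlen, hmem, hreg⟩ := ih (h.quotSMulTop hx) (by
      have h4 : Order.coheight p ≠ ⊤ := fun ht => by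
        rw [ht, add_top, top_le_iff] at hk; exact ENat.natCast_ne_top _ hk
      lift Order.coheight p to ℕ using h4 with c
      norm_cast at hk ⊢
      omega)
    exact ⟨x :: rs, by simp [hlen], by simpa [hxp] using hmem, .cons hx hreg⟩

end Depth

section RegularLocal

open RingTheory.Sequence IsLocalRing Pointwise

universe u

variable {S : Type u} [CommRing S] [IsLocalRing S]

theorem exists_span_insert_erase_eq_maximalIdeal [DecidableEq S] {s : Finset S}
    (hs : Ideal.span (s : Set S) = maximalIdeal S) {y : S} (hy : y ∈ maximalIdeal S)
    (hy2 : y ∉ maximalIdeal S ^ 2) :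
    ∃ a ∈ s, Ideal.span (insert y (s.erase a : Set S)) = maximalIdeal S := by
  have hmem : y ∈ Ideal.span (s : Set S) := hs ▸ hy
  obtain ⟨c, -, hc⟩ := Submodule.mem_span_finset.mp hmem
  obtain ⟨a, ha, hca⟩ : ∃ a ∈ s, IsUnit (c a) := by
    by_contra! hcon
    apply hy2
    rw [← hc, pow_two]
    refine Ideal.sum_mem _ fun a ha => Ideal.mul_mem_mul ((mem_maximalIdeal _).mpr (hcon a ha)) ?_
    rw [← hs]
    exact Ideal.subset_span ha
  have hsub : ∀ b ∈ s.erase a, b ∈ Ideal.span (insert y (s.erase a : Set S)) := fun b hb =>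
    Ideal.subset_span (Set.mem_insert_of_mem _ hb)
  refine ⟨a, ha, le_antisymm ?_ ?_⟩
  · rw [Ideal.span_le]
    rintro b (rfl | hb)
    · exact hy
    · rw [← hs]
      exact Ideal.subset_span (Finset.mem_of_mem_erase hb)
  · rw [← hs, Ideal.span_le]
    intro b hb
    by_cases hba : b = a
    · subst hba
      rw [SetLike.mem_coe, ← Ideal.unit_mul_mem_iff_mem _ hca]
      rw [← Finset.add_sum_erase _ _ ha, smul_eq_mul] at hc
      rw [eq_sub_of_add_eq hc]
      exact Ideal.sub_mem _ (Ideal.subset_span (Set.mem_insert _ _))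
        (Ideal.sum_mem _ fun e he => Ideal.mul_mem_left _ _ (hsub e he))
    · exact hsub b (Finset.mem_erase.mpr ⟨hba, hb⟩)

theorem Module.free_of_maximalIdeal_eq_bot (h : maximalIdeal S = ⊥) (M : Type*) [AddCommGroup M]
    [Module S M] : Module.Free S M := by
  let := (isField_iff_maximalIdeal_eq.mpr h).toField
  exact Module.Free.of_divisionRing S M

/-- Over a regular local ring every maximal Cohen-Macaulay module is free. -/
theorem DepthGE.free_of_span_eq_maximalIdeal [IsNoetherianRing S] {M : Type u} [AddCommGroup M]
    [Module S M] [Module.Finite S M] {n : ℕ} (h : DepthGE S n M) (s : Finset S)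
    (hs : Ideal.span (s : Set S) = maximalIdeal S) (hn : s.card ≤ n) : Module.Free S M := by
  classical
  induction n generalizing S M with
  | zero =>
    obtain rfl : s = ∅ := by simpa using hn
    exact Module.free_of_maximalIdeal_eq_bot (by simpa using hs.symm) M
  | succ n ih =>
    by_cases hbot : maximalIdeal S = ⊥
    · exact Module.free_of_maximalIdeal_eq_bot hbot M
    have hsq : ¬ maximalIdeal S ≤ maximalIdeal S ^ 2 := fun hle => hbot <|
      Submodule.eq_bot_of_le_smul_of_le_jacobson_bot (maximalIdeal S) _
        (IsNoetherian.noetherian _) (by rwa [smul_eq_mul, ← pow_two])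
        (jacobson_eq_maximalIdeal ⊥ bot_ne_top).ge
    obtain ⟨y, hym, hyu⟩ := Set.not_subset.mp <| mt (Ideal.subset_union_prime_finite
      ((associatedPrimes.finite S M).insert (maximalIdeal S ^ 2)) (f := id) (I := maximalIdeal S)
      (maximalIdeal S ^ 2) ⊥
      (fun q hq hne _ => (Set.mem_of_mem_insert_of_ne hq hne).isPrime)).mp <| by
        rintro ⟨q, rfl | hq, hle⟩
        · exact hsq hle
        · have h1 := h.le_coheight_of_mem_associatedPrimes ⟨q, hq.isPrime⟩ hq
          have h2 : Order.coheight (⟨q, hq.isPrime⟩ : PrimeSpectrum S) = 0 :=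
            Order.coheight_eq_zero.mpr fun r _ => (le_maximalIdeal r.2.ne_top).trans hle
          rw [h2] at h1
          simp at h1
    simp only [Set.biUnion_insert, id, Set.mem_union, not_or,
      biUnion_associatedPrimes_eq_compl_regular] at hyu
    have hreg : IsSMulRegular M y := not_not.mp hyu.2
    obtain ⟨a, ha, hspan⟩ := exists_span_insert_erase_eq_maximalIdeal hs hym hyu.1
    have : Nontrivial (S ⧸ Ideal.span {y}) := Ideal.Quotient.nontrivial_iff.mpr fun ht =>
      (maximalIdeal.isMaximal S).ne_top (top_le_iff.mp
        (ht.ge.trans ((Ideal.span_singleton_le_iff_mem _).mpr hym)))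
    have : IsLocalRing (S ⧸ Ideal.span {y}) :=
      .of_surjective' (Ideal.Quotient.mk _) Ideal.Quotient.mk_surjective
    have hmap := map_maximalIdeal_of_surjective (Ideal.Quotient.mk (Ideal.span {y}))
      Ideal.Quotient.mk_surjective
    have := Module.finitePresentation_of_finite S M
    rw [← Module.free_quotSMulTop_iff_free S M (x := y)
      ((jacobson_eq_maximalIdeal ⊥ bot_ne_top).ge hym) hreg]
    have : Module.Finite (S ⧸ Ideal.span {y}) (QuotSMulTop y M) :=
      Module.Finite.of_restrictScalars_finite S _ _
    refine ih ?_ ((s.erase a).image (Ideal.Quotient.mk _)) ?_ ?_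
    · obtain ⟨rs, hlen, hmem, hrs⟩ := h.quotSMulTop hreg
      refine ⟨rs.map (algebraMap S _), by simpa using hlen, ?_,
        (isWeaklyRegular_map_algebraMap_iff _ _ _).mpr hrs⟩
      simp only [List.mem_map, forall_exists_index, and_imp, forall_apply_eq_imp_iff₂]
      intro r hr
      rw [← hmap]
      exact Ideal.mem_map_of_mem _ (hmem r hr)
    · rw [← hmap, ← hspan, Ideal.map_span, Set.image_insert_eq, Finset.coe_image,
        Ideal.Quotient.eq_zero_iff_mem.mpr (Ideal.mem_span_singleton_self y)]
      exact (Submodule.span_insert_zero).symm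
    · refine Finset.card_image_le.trans ?_
      rw [Finset.card_erase_of_mem ha]
      omega

end RegularLocal

section NonfreeLocus

open RingTheory.Sequence IsLocalRing Order

variable {R : Type} [CommRing R] [IsLocalRing R] [IsNoetherianRing R]

theorem height_add_coheight_le_ringKrullDim {A : Type*} [CommRing A] (p : PrimeSpectrum A) :
    ((p.asIdeal.height + coheight p : ℕ∞) : WithBot ℕ∞) ≤ ringKrullDim A := by
  have : Nonempty (PrimeSpectrum A) := ⟨p⟩
  rw [ringKrullDim, krullDim_eq_iSup_height_add_coheight_of_nonempty, WithBot.coe_le_coe]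
  refine le_trans (le_of_eq ?_) (le_iSup (fun q : PrimeSpectrum A => height q + coheight q) p)
  rw [p.height_eq_orderHeight]

theorem nonfreeLocus_subset_singularLocus {d : ℕ} (hd : ringKrullDim R = d) (X : ModuleCat R)
    [Module.Finite R X] (hX : DepthGE R d X) : nonfreeLocus R X ⊆ singularLocus R := by
  intro p hp
  by_contra hreg
  simp only [singularLocus, Set.mem_ofPred_eq, not_not] at hreg
  obtain ⟨s, hs, hcard⟩ := hreg
  rw [IsLocalization.AtPrime.ringKrullDim_eq_height p.asIdeal] at hcard
  have hcard' : (s.card : ℕ∞) = p.asIdeal.height := by exact_mod_cast hcard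
  have hle := height_add_coheight_le_ringKrullDim p
  rw [hd, ← hcard'] at hle
  obtain ⟨rs, hlen, hmem, hrs⟩ := hX.exists_isWeaklyRegular_mem p (by exact_mod_cast hle)
  refine hp (DepthGE.free_of_span_eq_maximalIdeal (n := s.card) ?_ s hs le_rfl)
  refine ⟨rs.map (algebraMap R _), by simpa using hlen, ?_,
    hrs.of_isLocalizedModule _ p.asIdeal.primeCompl
      (LocalizedModule.mkLinearMap p.asIdeal.primeCompl X)⟩
  simp only [List.mem_map, forall_exists_index, and_imp, forall_apply_eq_imp_iff₂]
  intro r hr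
  rw [IsLocalization.AtPrime.to_map_mem_maximal_iff _ p.asIdeal]
  exact hmem r hr

end NonfreeLocus

section ResStep

variable {R : Type} [CommRing R]

/-- `M` is a direct summand of a finite direct sum of modules satisfying `P`. -/
def IsSummandOfSum (P : ModuleCat R → Prop) (M : ModuleCat R) : Prop :=
  ∃ (n : ℕ) (f : Fin n → ModuleCat R), (∀ i, P (f i)) ∧ IsSummand R M (finDirectSum R f)

theorem IsSummand.of_linearMap {M N : ModuleCat R} (i : N →ₗ[R] M) (p : M →ₗ[R] N)
    (h : ∀ x, p (i x) = x) : IsSummand R N M :=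
  ⟨ModuleCat.ofHom i, ModuleCat.ofHom p, by ext x; exact h x⟩

theorem IsSummand.exists_linearMap {M N : ModuleCat R} (h : IsSummand R N M) :
    ∃ (i : N →ₗ[R] M) (p : M →ₗ[R] N), ∀ x, p (i x) = x := by
  obtain ⟨i, p, hip⟩ := h
  exact ⟨i.hom, p.hom, fun x => by simpa using ConcreteCategory.congr_hom hip x⟩

theorem IsSummand.trans {L M N : ModuleCat R} (h₁ : IsSummand R L M) (h₂ : IsSummand R M N) :
    IsSummand R L N := by
  obtain ⟨i, p, hip⟩ := h₁
  obtain ⟨j, q, hjq⟩ := h₂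
  exact ⟨i ≫ j, q ≫ p, by rw [Category.assoc, reassoc_of% hjq, hip]⟩

theorem SES.of_linearMap {L M N : ModuleCat R} (f : L →ₗ[R] M) (g : M →ₗ[R] N)
    (hf : Function.Injective f) (hg : Function.Surjective g) (h : Function.Exact f g) :
    SES R L M N :=
  ⟨ModuleCat.ofHom f, ModuleCat.ofHom g, hf, hg, h⟩

namespace IsSummandOfSum

variable {P : ModuleCat R → Prop}

theorem of_pred {M : ModuleCat R} (h : P M) : IsSummandOfSum P M :=
  ⟨1, fun _ => M, fun _ => h, .of_linearMap (M := finDirectSum R fun _ : Fin 1 => M)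
    (LinearMap.pi fun _ => LinearMap.id) (LinearMap.proj (φ := fun _ : Fin 1 => M) 0)
    fun _ => rfl⟩

theorem of_subsingleton (M : ModuleCat R) [Subsingleton M] : IsSummandOfSum P M :=
  ⟨0, Fin.elim0, fun i => i.elim0, .of_linearMap 0 0 fun _ => Subsingleton.elim _ _⟩

theorem summand {M N : ModuleCat R} (h : IsSummand R N M) (hM : IsSummandOfSum P M) :
    IsSummandOfSum P N := by
  obtain ⟨n, f, hf, hs⟩ := hM
  exact ⟨n, f, hf, h.trans hs⟩

theorem finDirectSum {k : ℕ} {g : Fin k → ModuleCat R} (h : ∀ i, IsSummandOfSum P (g i)) :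
    IsSummandOfSum P (finDirectSum R g) := by
  choose n f hf hs using h
  choose i p hip using fun a => (hs a).exists_linearMap
  let e := Fintype.equivFin (Σ a, Fin (n a))
  let E : (∀ a b, f a b) ≃ₗ[R] ∀ j, f (e.symm j).1 (e.symm j).2 :=
    (LinearEquiv.piCurry R fun a b => (f a b : Type _)).symm.trans
      (LinearEquiv.piCongrLeft' R (fun ab : Σ a, Fin (n a) => (f ab.1 ab.2 : Type _)) e)
  refine ⟨_, fun j => f (e.symm j).1 (e.symm j).2, fun j => hf _ _, .of_linearMap
    (E.toLinearMap ∘ₗ LinearMap.pi fun a => i a ∘ₗ LinearMap.proj a)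
    ((LinearMap.pi fun a => p a ∘ₗ LinearMap.proj a) ∘ₗ E.symm.toLinearMap) fun x => ?_⟩
  refine funext fun a => ?_
  exact (congrArg (fun v : ∀ a b, f a b => p a (v a))
    (E.symm_apply_apply fun b => i b (x b))).trans (hip a _)

theorem mono {Q : ModuleCat R → Prop} (hPQ : ∀ M, P M → Q M) {M : ModuleCat R}
    (h : IsSummandOfSum P M) : IsSummandOfSum Q M := by
  obtain ⟨n, f, hf, hs⟩ := h
  exact ⟨n, f, fun i => hPQ _ (hf i), hs⟩

theorem bind {Q : ModuleCat R → Prop} (hPQ : ∀ M, P M → IsSummandOfSum Q M) {M : ModuleCat R}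
    (h : IsSummandOfSum P M) : IsSummandOfSum Q M := by
  obtain ⟨n, f, hf, hs⟩ := h
  exact (finDirectSum fun i => hPQ _ (hf i)).summand hs

end IsSummandOfSum

theorem mem_resStep_zero {X M : ModuleCat R} :
    M ∈ resStep R X 0 ↔ IsSummandOfSum (fun N => N = X ∨ N = ModuleCat.of R R) M :=
  Iff.rfl

theorem mem_resStep_succ {X M : ModuleCat R} {n : ℕ} :
    M ∈ resStep R X (n + 1) ↔ IsSummandOfSum (fun N =>
      (∃ A B, A ∈ resStep R X n ∧ B ∈ resStep R X n ∧ SES R A N B) ∨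
      (∃ A B, A ∈ resStep R X n ∧ B ∈ resStep R X n ∧ SES R N A B)) M :=
  Iff.rfl

theorem subsingleton_mem_resStep (X : ModuleCat R) (n : ℕ) (M : ModuleCat R) [Subsingleton M] :
    M ∈ resStep R X n := by
  cases n with
  | zero => exact mem_resStep_zero.mpr (.of_subsingleton M)
  | succ n => exact mem_resStep_succ.mpr (.of_subsingleton M)

theorem resStep_succ_of_extension {X A M B : ModuleCat R} {n : ℕ} (h : SES R A M B)
    (hA : A ∈ resStep R X n) (hB : B ∈ resStep R X n) : M ∈ resStep R X (n + 1) :=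
  mem_resStep_succ.mpr (.of_pred (.inl ⟨A, B, hA, hB, h⟩))

theorem resStep_succ_of_kernel {X A M B : ModuleCat R} {n : ℕ} (h : SES R M A B)
    (hA : A ∈ resStep R X n) (hB : B ∈ resStep R X n) : M ∈ resStep R X (n + 1) :=
  mem_resStep_succ.mpr (.of_pred (.inr ⟨A, B, hA, hB, h⟩))

theorem self_mem_resStep_zero (X : ModuleCat R) : X ∈ resStep R X 0 :=
  mem_resStep_zero.mpr (.of_pred (.inl rfl))

theorem free_mem_resStep_zero (X : ModuleCat R) (k : ℕ) :
    ModuleCat.of R (Fin k → R) ∈ resStep R X 0 :=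
  ⟨k, fun _ => ModuleCat.of R R, fun _ => .inr rfl, .of_linearMap .id .id fun _ => rfl⟩

theorem resStep_subset_succ (X : ModuleCat R) (n : ℕ) : resStep R X n ⊆ resStep R X (n + 1) :=
  fun _ hM => resStep_succ_of_extension (B := ModuleCat.of R PUnit)
    (.of_linearMap .id 0 Function.injective_id (fun _ => ⟨0, Subsingleton.elim _ _⟩)
      fun y => ⟨fun _ => ⟨y, rfl⟩, fun _ => rfl⟩) hM (subsingleton_mem_resStep X n _)

theorem resStep_mono (X : ModuleCat R) : Monotone (resStep R X) :=
  monotone_nat_of_le_succ (resStep_subset_succ X)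

theorem ring_mem_resStep (X : ModuleCat R) (n : ℕ) : ModuleCat.of R R ∈ resStep R X n :=
  resStep_mono X n.zero_le (mem_resStep_zero.mpr (.of_pred (.inr rfl)))

theorem resStep_of_isSummandOfSum {X M : ModuleCat R} {n : ℕ}
    (h : IsSummandOfSum (· ∈ resStep R X n) M) : M ∈ resStep R X n := by
  cases n with
  | zero => exact mem_resStep_zero.mpr (h.bind fun _ => mem_resStep_zero.mp)
  | succ n => exact mem_resStep_succ.mpr (h.bind fun _ => mem_resStep_succ.mp)

theorem resStep_trans {X N Y : ModuleCat R} {a b : ℕ} (hN : N ∈ resStep R X a)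
    (hY : Y ∈ resStep R N b) : Y ∈ resStep R X (a + b) := by
  induction b generalizing Y with
  | zero =>
    refine resStep_of_isSummandOfSum ((mem_resStep_zero.mp hY).mono ?_)
    rintro M (rfl | rfl)
    · exact hN
    · exact ring_mem_resStep X a
  | succ b ih =>
    refine mem_resStep_succ.mpr ((mem_resStep_succ.mp hY).mono ?_)
    rintro M (⟨A, B, hA, hB, h⟩ | ⟨A, B, hA, hB, h⟩)
    · exact .inl ⟨A, B, ih hA, ih hB, h⟩
    · exact .inr ⟨A, B, ih hA, ih hB, h⟩

end ResStep

section Pushout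

open IsLocalRing

section Split

variable {A L M N : Type*} [Ring A] [AddCommGroup L] [AddCommGroup M] [AddCommGroup N]
  [Module A L] [Module A M] [Module A N] {f : L →ₗ[A] M} {g : M →ₗ[A] N}

theorem Function.Exact.nonempty_equiv_prod_of_projective (h : Function.Exact f g)
    (hf : Function.Injective f) (hg : Function.Surjective g) [Module.Projective A N] :
    Nonempty (M ≃ₗ[A] L × N) := by
  obtain ⟨e, -⟩ := ((h.split_tfae hf hg).out 0 2).mp 
    (Module.projective_lifting_property g LinearMap.id hg)
  exact ⟨e⟩

theorem Function.Exact.projective_middle (h : Function.Exact f g)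
    (hf : Function.Injective f) (hg : Function.Surjective g) [Module.Projective A N]
    [Module.Projective A L] : Module.Projective A M :=
  let ⟨e⟩ := h.nonempty_equiv_prod_of_projective hf hg
  .of_equiv e.symm

theorem Function.Exact.projective_kernel (h : Function.Exact f g)
    (hf : Function.Injective f) (hg : Function.Surjective g) [Module.Projective A N]
    [Module.Projective A M] : Module.Projective A L :=
  let ⟨e⟩ := h.nonempty_equiv_prod_of_projective hf hg
  have : Module.Projective A (L × N) := .of_equiv e
  .of_split (LinearMap.inl A L N) (LinearMap.fst A L N) (by ext; simp)

end Split

variable {R : Type*} [CommRing R] {F X : Type*} [AddCommGroup F] [AddCommGroup X] [Module R F]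
  [Module R X]

/-- The pushout of the syzygy sequence `0 → ker π → F → X → 0` along multiplication by `x` on
`ker π`. -/
structure SyzygyPushout (π : F →ₗ[R] X) (x : R) (N : Type*) [AddCommGroup N] [Module R N] where
  /-- The inclusion of the kernel of `π`. -/
  ι : LinearMap.ker π →ₗ[R] N
  /-- The projection to `X`. -/
  ρ : N →ₗ[R] X
  /-- The comparison map from `F`. -/
  j : F →ₗ[R] N
  injective_ι : Function.Injective ι
  surjective_ρ : Function.Surjective ρ
  exact : Function.Exact ι ρ
  ρ_j : ∀ v, ρ (j v) = π v
  j_coe : ∀ a : LinearMap.ker π, j a = x • ι a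

/-- The graph by which one divides `F × ker π` to form the pushout. -/
def syzygyPushoutRelations (π : F →ₗ[R] X) (x : R) : Submodule R (F × LinearMap.ker π) :=
  LinearMap.range ((LinearMap.ker π).subtype.prod (-(x • LinearMap.id)))

/-- The standard model of the pushout. -/
def syzygyPushout {π : F →ₗ[R] X} (hπ : Function.Surjective π) (x : R) :
    SyzygyPushout π x ((F × LinearMap.ker π) ⧸ syzygyPushoutRelations π x) where
  ι := (syzygyPushoutRelations π x).mkQ ∘ₗ LinearMap.inr R _ _
  ρ := (syzygyPushoutRelations π x).liftQ (π ∘ₗ LinearMap.fst R _ _) (by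
    rintro _ ⟨a, rfl⟩
    simp)
  j := (syzygyPushoutRelations π x).mkQ ∘ₗ LinearMap.inl R _ _
  injective_ι := by
    rw [injective_iff_map_eq_zero]
    intro k hk
    obtain ⟨a, ha⟩ := (Submodule.Quotient.mk_eq_zero _).mp hk
    simp only [LinearMap.prod_apply, Function.prod_apply, LinearMap.inr_apply, Prod.mk.injEq,
      Submodule.subtype_apply, ZeroMemClass.coe_eq_zero] at ha
    rw [← ha.2, ha.1, map_zero]
  surjective_ρ v := by
    obtain ⟨w, rfl⟩ := hπ v
    exact ⟨Submodule.Quotient.mk (w, 0), rfl⟩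
  exact := by
    intro n
    constructor
    · obtain ⟨⟨v, k⟩, rfl⟩ := Submodule.Quotient.mk_surjective _ n
      intro (hv : π v = 0)
      refine ⟨k + x • ⟨v, hv⟩, ?_⟩
      refine (Submodule.Quotient.eq _).mpr ⟨-⟨v, hv⟩, ?_⟩
      ext <;> simp
    · rintro ⟨k, rfl⟩
      exact map_zero π
  ρ_j _ := rfl
  j_coe a := by
    refine (Submodule.Quotient.eq _).mpr ⟨a, ?_⟩
    ext <;> simp

namespace SyzygyPushout

variable {π : F →ₗ[R] X} {x : R} {N : Type*} [AddCommGroup N] [Module R N]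

/-- If `x` lies in the maximal ideal, the pushout is projective only if `X` is. -/
theorem projective_of_projective (P : SyzygyPushout π x N) [IsLocalRing R] [IsNoetherianRing R]
    [Module.Finite R F] [Module.Projective R F] (hπ : Function.Surjective π) (hx : x ∈ maximalIdeal R)
    [Module.Projective R N] : Module.Projective R X := by
  obtain ⟨g, hg⟩ := Module.projective_lifting_property π P.ρ hπ
  have hg' : ∀ n, π (g n) = P.ρ n := LinearMap.congr_fun hg
  let ψ : F →ₗ[R] LinearMap.ker π := (g ∘ₗ P.j - LinearMap.id).codRestrict _ fun v => by
    simp [hg', P.ρ_j]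
  have hψ : ∀ a : LinearMap.ker π, ∃ b : LinearMap.ker π, ψ a = x • b - a := fun a => by
    refine ⟨⟨g (P.ι a), ?_⟩, Subtype.ext ?_⟩
    · rw [LinearMap.mem_ker, hg']
      exact P.exact.apply_apply_eq_zero a
    · simp [ψ, P.j_coe]
  let φ : LinearMap.ker π →ₗ[R] LinearMap.ker π := ψ ∘ₗ (LinearMap.ker π).subtype
  have hsurj : Function.Surjective φ := by
    rw [← LinearMap.range_eq_top, ← top_le_iff]
    refine Submodule.le_of_le_smul_of_le_jacobson_bot (IsNoetherian.noetherian _)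
      (jacobson_eq_maximalIdeal ⊥ bot_ne_top).ge fun a _ => ?_
    obtain ⟨b, hb⟩ := hψ a
    have hab : a = φ (-a) + x • b := by
      rw [map_neg]
      change a = -ψ a + x • b
      rw [hb]
      abel
    rw [hab]
    exact Submodule.add_mem_sup ⟨_, rfl⟩ (Submodule.smul_mem_smul hx trivial)
  let e := LinearEquiv.ofBijective φ
    ⟨IsNoetherian.injective_of_surjective_endomorphism φ hsurj, hsurj⟩
  have hexact : Function.Exact (LinearMap.ker π).subtype π := LinearMap.exact_subtype_ker_map π
  have hretract : ∃ l, l ∘ₗ (LinearMap.ker π).subtype = LinearMap.id :=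
    ⟨e.symm.toLinearMap ∘ₗ ψ, LinearMap.ext fun a => e.symm_apply_apply a⟩
  obtain ⟨l, hl⟩ := ((hexact.split_tfae Subtype.val_injective hπ).out 1 0).mp hretract
  exact .of_split l π hl

theorem exists_j_eq_smul (P : SyzygyPushout π x N) (hπ : Function.Surjective π) (n : N) :
    ∃ v, P.j v = x • n := by
  obtain ⟨v, hv⟩ := hπ (P.ρ n)
  obtain ⟨k, hk⟩ := (P.exact (n - P.j v)).mp (by rw [map_sub, P.ρ_j, hv, sub_self])
  refine ⟨k + x • v, ?_⟩
  rw [map_add, P.j_coe, hk, map_smul, smul_sub, sub_add_cancel]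

theorem smul_eq_zero_of_j_eq_zero (P : SyzygyPushout π x N) {v : F} (hv : P.j v = 0) :
    x • v = 0 := by
  have hmem : v ∈ LinearMap.ker π := by rw [LinearMap.mem_ker, ← P.ρ_j, hv, map_zero]
  have h : P.ι (x • ⟨v, hmem⟩) = 0 := by rw [map_smul, ← P.j_coe, hv]
  exact congrArg Subtype.val ((injective_iff_map_eq_zero _).mp P.injective_ι _ h)

/-- Away from `x` the pushout is isomorphic to `F`. -/
theorem isLocalizedModule (P : SyzygyPushout π x N) (hπ : Function.Surjective π)
    (S : Submonoid R) (hx : x ∈ S) : IsLocalizedModule S (LocalizedModule.mkLinearMap S N ∘ₗ P.j) where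
  map_units := IsLocalizedModule.map_units (LocalizedModule.mkLinearMap S N)
  surj y := by
    obtain ⟨⟨n, s⟩, hs⟩ := IsLocalizedModule.surj S (LocalizedModule.mkLinearMap S N) y
    obtain ⟨v, hv⟩ := P.exists_j_eq_smul hπ n
    refine ⟨⟨v, ⟨x, hx⟩ * s⟩, ?_⟩
    rw [mul_smul, hs, LinearMap.comp_apply, hv, map_smul]
    rfl
  exists_of_eq {a b} hab := by
    obtain ⟨t, ht⟩ := IsLocalizedModule.exists_of_eq (S := S)
      (f := LocalizedModule.mkLinearMap S N) hab
    refine ⟨⟨x, hx⟩ * t, ?_⟩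
    rw [mul_smul, mul_smul, ← sub_eq_zero, ← smul_sub, ← smul_sub]
    refine P.smul_eq_zero_of_j_eq_zero ?_
    change P.j ((t : R) • (a - b)) = 0
    rw [map_smul, map_sub, smul_sub, sub_eq_zero]
    exact ht

theorem free_localizedModule (P : SyzygyPushout π x N) [Module.Free R F]
    (hπ : Function.Surjective π) (S : Submonoid R) (hx : x ∈ S) :
    Module.Free (Localization S) (LocalizedModule S N) :=
  have := P.isLocalizedModule hπ S hx
  Module.free_of_isLocalizedModule S (LocalizedModule.mkLinearMap S N ∘ₗ P.j)

theorem projective_localizedModule (P : SyzygyPushout π x N) [Module.Projective R F]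
    (hπ : Function.Surjective π) (S : Submonoid R) [Module.Projective (Localization S) (LocalizedModule S X)] :
    Module.Projective (Localization S) (LocalizedModule S N) := by
  have hexact : Function.Exact (LinearMap.ker π).subtype π := LinearMap.exact_subtype_ker_map π
  have : Module.Projective (Localization S) (LocalizedModule S F) := inferInstance
  have := Function.Exact.projective_kernel
    (f := LocalizedModule.map S (LinearMap.ker π).subtype) (g := LocalizedModule.map S π)
    (LocalizedModule.map_exact S _ _ hexact)
    (LocalizedModule.map_injective S _ Subtype.val_injective)
    (LocalizedModule.map_surjective S _ hπ)
  exact Function.Exact.projective_middle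
    (f := LocalizedModule.map S P.ι) (g := LocalizedModule.map S P.ρ)
    (LocalizedModule.map_exact S _ _ P.exact)
    (LocalizedModule.map_injective S _ P.injective_ι)
    (LocalizedModule.map_surjective S _ P.surjective_ρ)

end SyzygyPushout

end Pushout

section Reduction

open RingTheory.Sequence IsLocalRing

variable {R : Type} [CommRing R] [IsNoetherianRing R]

theorem isClosed_nonfreeLocus (X : ModuleCat R) [Module.Finite R X] :
    IsClosed (nonfreeLocus R X) :=
  have := Module.finitePresentation_of_finite R X
  (Module.isOpen_freeLocus (R := R) (M := X)).isClosed_compl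

variable [IsLocalRing R]

theorem exists_nonfree_nonfreeLocus_subset_zeroLocus {d : ℕ} (hR : DepthGE R d R)
    {X : ModuleCat R} [Module.Finite R X] (hX : DepthGE R d X) (hfree : ¬ Module.Free R X) {x : R}
    (hx : x ∈ maximalIdeal R) :
    ∃ N : ModuleCat R, Module.Finite R N ∧ DepthGE R d N ∧ ¬ Module.Free R N ∧
      N ∈ resStep R X 2 ∧ ∀ q ∈ nonfreeLocus R N, q ∈ nonfreeLocus R X ∧ x ∈ q.asIdeal := by
  obtain ⟨k, π, hπ⟩ := Module.Finite.exists_fin' R X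
  let P := syzygyPushout hπ x
  have hexact : Function.Exact (LinearMap.ker π).subtype π := LinearMap.exact_subtype_ker_map π
  have hK : DepthGE R d (LinearMap.ker π) :=
    DepthGE.kernel Subtype.val_injective hπ hexact (hR.pi_fin k) hX
  refine ⟨ModuleCat.of R (((Fin k → R) × LinearMap.ker π) ⧸ syzygyPushoutRelations π x),
    inferInstance, .extension P.injective_ι P.surjective_ρ P.exact hK hX, fun hN => hfree ?_, ?_,
    fun q hq => ⟨fun hqX => hq ?_, not_not.mp fun hqx => hq ?_⟩⟩
  · have := P.projective_of_projective hπ hx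
    exact Module.free_of_flat_of_isLocalRing
  · refine resStep_succ_of_extension (A := ModuleCat.of R (LinearMap.ker π)) (B := X)
      (.of_linearMap P.ι P.ρ P.injective_ι P.surjective_ρ P.exact) ?_
      (resStep_subset_succ X 0 (self_mem_resStep_zero X))
    exact resStep_succ_of_kernel (A := ModuleCat.of R (Fin k → R)) (B := X)
      (.of_linearMap (LinearMap.ker π).subtype π Subtype.val_injective hπ hexact)
      (free_mem_resStep_zero X k) (self_mem_resStep_zero X)
  · have hqX' : Module.Free (Localization q.asIdeal.primeCompl)
        (LocalizedModule q.asIdeal.primeCompl X) := hqX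
    have hproj : Module.Projective (Localization q.asIdeal.primeCompl)
        (LocalizedModule q.asIdeal.primeCompl X) := Module.Projective.of_free
    have := P.projective_localizedModule hπ q.asIdeal.primeCompl
    exact Module.free_of_flat_of_isLocalRing
  · exact P.free_localizedModule hπ q.asIdeal.primeCompl hqx

/-- An element of the maximal ideal outside the primes of maximal dimension in a closed set. -/
theorem exists_mem_maximalIdeal_forall_coheight_le {Z : Set (PrimeSpectrum R)} (hZ : IsClosed Z)
    {n : ℕ} (hn : ∀ p ∈ Z, Order.coheight p ≤ (n + 1 : ℕ)) :
    ∃ x ∈ maximalIdeal R, ∀ p ∈ Z, x ∈ p.asIdeal → Order.coheight p ≤ n := by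
  obtain ⟨I, rfl⟩ := (PrimeSpectrum.isClosed_iff_zeroLocus_ideal _).mp hZ
  obtain ⟨x, hxm, hx⟩ := Set.not_subset.mp <| mt (Ideal.subset_union_prime_finite
    ((Ideal.finite_minimalPrimes_of_isNoetherianRing R I).subset
      (Set.sep_subset _ fun q => ¬ maximalIdeal R ≤ q))
    (f := id) (I := maximalIdeal R) ⊥ ⊥ (fun q hq _ _ => hq.1.1.1)).mp <| by
      rintro ⟨q, hq, hle⟩
      exact hq.2 hle
  refine ⟨x, hxm, fun p hp hxp => not_lt.mp fun hlt => hx ?_⟩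
  have hlt' : ((n + 1 : ℕ) : ℕ∞) ≤ Order.coheight p := by
    push_cast
    exact Order.add_one_le_of_lt hlt
  refine Set.mem_biUnion (x := p.asIdeal) ⟨⟨⟨p.2, hp⟩, fun q hq hqp => ?_⟩, fun hle => ?_⟩ hxp
  · by_contra hpq
    have hlt : (⟨q, hq.1⟩ : PrimeSpectrum R) < p := lt_of_le_not_ge hqp hpq
    have := (Order.coheight_add_one_le hlt).trans (hn ⟨q, hq.1⟩ hq.2)
    have h := (add_le_add_left hlt' 1).trans this
    norm_cast at h
    omega
  · have : Order.coheight p = 0 :=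
      Order.coheight_eq_zero.mpr fun r _ => (le_maximalIdeal r.2.ne_top).trans hle
    rw [this] at hlt'
    simp at hlt'

theorem exists_nonfree_free_on_punctured {d : ℕ} (hR : DepthGE R d R) (n : ℕ) (X : ModuleCat R)
    [Module.Finite R X] (hX : DepthGE R d X) (hfree : ¬ Module.Free R X)
    (hn : ∀ p ∈ nonfreeLocus R X, Order.coheight p ≤ n) :
    ∃ Y : ModuleCat R, Module.Finite R Y ∧ DepthGE R d Y ∧ ¬ Module.Free R Y ∧
      Y ∈ resStep R X (2 * n) ∧ ∀ p ∈ nonfreeLocus R Y, p.asIdeal = maximalIdeal R := by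
  induction n generalizing X with
  | zero =>
    refine ⟨X, inferInstance, hX, hfree, self_mem_resStep_zero X, fun p hp => ?_⟩
    have hmax := Order.coheight_eq_zero.mp (nonpos_iff_eq_zero.mp (hn p hp))
    exact le_antisymm (le_maximalIdeal p.2.ne_top)
      (hmax (b := closedPoint R) (le_maximalIdeal p.2.ne_top))
  | succ n ih =>
    obtain ⟨x, hx, hxn⟩ := exists_mem_maximalIdeal_forall_coheight_le (isClosed_nonfreeLocus X) hn
    obtain ⟨N, hNfin, hN, hNfree, hNX, hNq⟩ :=
      exists_nonfree_nonfreeLocus_subset_zeroLocus hR hX hfree hx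
    obtain ⟨Y, hYfin, hY, hYfree, hYN, hYm⟩ := ih N hN hNfree fun p hp =>
      hxn p (hNq p hp).1 (hNq p hp).2
    exact ⟨Y, hYfin, hY, hYfree, resStep_mono X (by omega) (resStep_trans hNX hYN), hYm⟩

theorem closedPoint_mem_nonfreeLocus {X : ModuleCat R} [Module.Finite R X]
    (hfree : ¬ Module.Free R X) : closedPoint R ∈ nonfreeLocus R X := by
  have := Module.finitePresentation_of_finite R X
  by_contra hmem
  have hempty : nonfreeLocus R X = ∅ := Set.eq_empty_of_forall_notMem fun p hp => hmem <|
    ((PrimeSpectrum.le_iff_specializes p (closedPoint R)).mp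
      (le_maximalIdeal p.2.ne_top)).mem_closed (isClosed_nonfreeLocus X) hp
  have huniv : Module.freeLocus R X = Set.univ :=
    Set.eq_univ_of_forall fun p => not_not.mp (Set.eq_empty_iff_forall_notMem.mp hempty p)
  have := Module.freeLocus_eq_univ_iff.mp huniv
  exact hfree Module.free_of_flat_of_isLocalRing

theorem DepthGE.of_moduleDepth_eq {M : Type} [AddCommGroup M] [Module R M] [Module.Finite R M]
    {d : ℕ} (h : moduleDepth R M = d) : DepthGE R d M := by
  by_contra hcon
  have hlt : ∀ rs : List R, (∀ r ∈ rs, r ∈ maximalIdeal R) ∧ IsRegular M rs → rs.length < d :=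
    fun rs hrs => not_le.mp fun hle =>
      hcon (DepthGE.mono hle ⟨rs, rfl, hrs.1, hrs.2.toIsWeaklyRegular⟩)
  have hd : d ≠ 0 := by
    rintro rfl
    exact hcon ⟨[], rfl, by simp, .nil R M⟩
  have hle : moduleDepth R M ≤ (d - 1 : ℕ) := iSup₂_le fun rs hrs => by
    have := hlt rs hrs
    exact_mod_cast (by omega : rs.length ≤ d - 1)
  rw [h] at hle
  norm_cast at hle
  omega

theorem DepthGE.moduleDepth_eq {M : Type} [AddCommGroup M] [Module R M] [Module.Finite R M]
    [Nontrivial M] {d : ℕ} (hd : ringKrullDim R = d) (h : DepthGE R d M) :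
    moduleDepth R M = d := by
  refine le_antisymm (iSup₂_le fun rs hrs => ?_) ?_
  · have hdim := Module.supportDim_add_length_eq_supportDim_of_isRegular rs hrs.2
    have hnt : Nontrivial (M ⧸ (Ideal.ofList rs • ⊤ : Submodule R M)) :=
      Submodule.Quotient.nontrivial_iff.mpr hrs.2.top_ne_smul.symm
    have hle := Module.supportDim_le_ringKrullDim R M
    rw [← hdim, hd] at hle
    obtain ⟨t, ht⟩ := WithBot.ne_bot_iff_exists.mp
      (Module.supportDim_ne_bot_of_nontrivial (R := R)
        (M := M ⧸ (Ideal.ofList rs • ⊤ : Submodule R M)))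
    rw [← ht] at hle
    have hle' : t + (rs.length : ℕ∞) ≤ d := by exact_mod_cast hle
    exact le_add_self.trans hle'
  · obtain ⟨rs, hlen, hmem, hreg⟩ := h
    rw [← hlen]
    exact le_iSup₂ (f := fun (rs : List R) (_ : (∀ r ∈ rs, r ∈ maximalIdeal R) ∧ IsRegular M rs) =>
      (rs.length : ℕ∞)) rs ⟨hmem, .of_isWeaklyRegular_of_mem_maximalIdeal _ hmem hreg⟩

end Reduction

theorem exists_nat_ringKrullDim_eq (R : Type) [CommRing R] [IsNoetherianRing R] [IsLocalRing R] :
    ∃ d : ℕ, ringKrullDim R = d := by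
  obtain ⟨t, ht⟩ := WithBot.ne_bot_iff_exists.mp (ringKrullDim_ne_bot (R := R))
  have htop := ringKrullDim_ne_top (R := R)
  rw [← ht] at htop ⊢
  obtain ⟨d, rfl⟩ := ENat.ne_top_iff_exists.mp fun h : t = ⊤ => htop (by rw [h]; rfl)
  exact ⟨d, rfl⟩

theorem exists_nat_dimSet_eq {R : Type} [CommRing R] {d : ℕ} (hd : ringKrullDim R = d)
    {Z : Set (PrimeSpectrum R)} {q : PrimeSpectrum R} (hq : q ∈ Z) :
    ∃ n : ℕ, dimSet R Z = n ∧ ∀ p ∈ Z, Order.coheight p ≤ n := by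
  have hle : ∀ p ∈ Z, (Order.coheight p : WithBot ℕ∞) ≤ dimSet R Z := fun p hp => by
    rw [← ringKrullDim_quotient_eq_coheight]
    exact le_iSup₂ (f := fun (p : PrimeSpectrum R) (_ : p ∈ Z) => ringKrullDim (R ⧸ p.asIdeal)) p hp
  have hdim : dimSet R Z ≤ d := hd ▸ iSup₂_le fun p _ => ringKrullDim_quotient_le p.asIdeal
  have hbot : dimSet R Z ≠ ⊥ := fun h => by simpa [h] using hle q hq
  obtain ⟨t, ht⟩ := WithBot.ne_bot_iff_exists.mp hbot
  rw [← ht] at hdim hle ⊢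
  have htd : t ≤ d := WithBot.coe_le_coe.mp hdim
  obtain ⟨n, rfl⟩ := ENat.ne_top_iff_exists.mp (ne_top_of_le_ne_top (ENat.natCast_ne_top d) htd)
  exact ⟨n, rfl, fun p hp => WithBot.coe_le_coe.mp (hle p hp)⟩

/-- Over a Cohen-Macaulay noetherian local ring, every nonfree
maximal Cohen-Macaulay module `X` admits a nonfree maximal Cohen-Macaulay module
`Y` with `step(X,Y) ≤ 2·dim Sing R` which is free on the punctured spectrum. -/
theorem stmt15 (R : Type) [CommRing R] [IsNoetherianRing R] [IsLocalRing R]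
    (hCM : (moduleDepth R R : WithBot ℕ∞) = ringKrullDim R)
    (X : ModuleCat R) (hXfin : Module.Finite R X)
    (hXcm : (moduleDepth R X : WithBot ℕ∞) = ringKrullDim R)
    (hXfree : ¬ Module.Free R X) :
    ∃ Y : ModuleCat R, Module.Finite R Y ∧
      (moduleDepth R Y : WithBot ℕ∞) = ringKrullDim R ∧
      ¬ Module.Free R Y ∧
      (step R X Y : WithBot ℕ∞) ≤ 2 * dimSet R (singularLocus R) ∧
      ∀ p : PrimeSpectrum R, p.asIdeal ≠ IsLocalRing.maximalIdeal R →
        Module.Free (Localization.AtPrime p.asIdeal)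
          (LocalizedModule p.asIdeal.primeCompl Y) := by
  obtain ⟨d, hd⟩ : ∃ d : ℕ, ringKrullDim R = d := exists_nat_ringKrullDim_eq R
  have hR : DepthGE R d R := .of_moduleDepth_eq (by rw [hd] at hCM; exact_mod_cast hCM)
  have hX : DepthGE R d X := .of_moduleDepth_eq (by rw [hd] at hXcm; exact_mod_cast hXcm)
  have hsub := nonfreeLocus_subset_singularLocus hd X hX
  obtain ⟨n, hn, hle⟩ := exists_nat_dimSet_eq hd
    (hsub (closedPoint_mem_nonfreeLocus hXfree))
  obtain ⟨Y, hYfin, hY, hYfree, hYX, hYm⟩ :=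
    exists_nonfree_free_on_punctured hR n X hX hXfree fun p hp => hle p (hsub hp)
  have : Nontrivial Y := by
    by_contra h
    have := not_nontrivial_iff_subsingleton.mp h
    exact hYfree inferInstance
  refine ⟨Y, hYfin, by rw [hY.moduleDepth_eq hd, hd]; rfl, hYfree, ?_, fun p hp => ?_⟩
  · have hstep : step R X Y ≤ (2 * n : ℕ) := sInf_le ⟨2 * n, rfl, hYX⟩
    rw [hn]
    exact (WithBot.coe_le_coe.mpr hstep).trans_eq (by push_cast; rfl)
  · by_contra h
    exact hp (hYm p h)
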